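/- Let n ∈ ℕ, α > 1, f ∈ SR_α, c ∈ (1−α/2, 1) and δ > 0. Then there exists k > 0 such that for every ρ > k and every z ∈ ℝⁿ with ‖z‖ ≤ ρ^c: | f(‖ρ·e₁ + z‖) − f(ρ) − z₁·f′(ρ) − (1/2)·f″(ρ)·(z₁² + (α−1)⁻¹·Σ_{i=2}^{n} z_i²) | ≤ δ·‖z‖²·f″(ρ), where e₁ is the first standard basis vector of ℝⁿ and z = (z₁,…,z_n). -/

import Mathlib

open MeasureTheory Filter Real Set
open scoped Topology BigOperators ENNReal

noncomputable section

/-- `f` is smoothly regularly varying of index `α`: beyond some `z₀ ≥ 1` it is positive and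
infinitely differentiable, and `h u = log (f (exp u))` satisfies `h' → α` and
`h^(m) → 0` for every `m ≥ 2`. -/
def SmoothRegVary (α : ℝ) (f : ℝ → ℝ) : Prop :=
  ∃ z₀ : ℝ, 1 ≤ z₀ ∧ (∀ x, z₀ < x → 0 < f x) ∧
    ContDiffOn ℝ (⊤ : ℕ∞) f (Set.Ioi z₀) ∧
    Filter.Tendsto (deriv (fun u => Real.log (f (Real.exp u)))) Filter.atTop (nhds α) ∧
    ∀ m : ℕ, 2 ≤ m →
      Filter.Tendsto (iteratedDeriv m (fun u => Real.log (f (Real.exp u))))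
        Filter.atTop (nhds 0)

namespace SmoothRegVary

variable {α : ℝ} {f : ℝ → ℝ}

lemma hasDerivAt_of_contDiffOn_Ioi {z₀ : ℝ} (h : ContDiffOn ℝ (⊤ : ℕ∞) f (Set.Ioi z₀)) {x : ℝ}
    (hx : z₀ < x) :
    HasDerivAt f (deriv f x) x ∧ HasDerivAt (deriv f) (deriv (deriv f) x) x := by
  have hd : ContDiffOn ℝ 1 (deriv f) (Set.Ioi z₀) :=
    h.deriv_of_isOpen isOpen_Ioi (WithTop.coe_le_coe.2 (le_top : (1 + 1 : ℕ∞) ≤ ⊤))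
  exact ⟨((h.differentiableOn (by simp)).differentiableAt (Ioi_mem_nhds hx)).hasDerivAt,
    ((hd.differentiableOn one_ne_zero).differentiableAt (Ioi_mem_nhds hx)).hasDerivAt⟩

lemma hasDerivAt_log_comp_exp {z₀ : ℝ} (hpos : ∀ x, z₀ < x → 0 < f x)
    (h : ContDiffOn ℝ (⊤ : ℕ∞) f (Set.Ioi z₀)) {u : ℝ} (hu : z₀ < exp u) :
    HasDerivAt (fun u => Real.log (f (exp u))) (exp u * deriv f (exp u) / f (exp u)) u := by
  have h1 := ((hasDerivAt_of_contDiffOn_Ioi h hu).1.comp u (Real.hasDerivAt_exp u)).log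
    (hpos _ hu).ne'
  rw [mul_comm (exp u)]
  exact h1

lemma iteratedDeriv_two_log_comp_exp {z₀ : ℝ} (hpos : ∀ x, z₀ < x → 0 < f x)
    (h : ContDiffOn ℝ (⊤ : ℕ∞) f (Set.Ioi z₀)) {u : ℝ} (hu : z₀ < exp u) :
    iteratedDeriv 2 (fun u => Real.log (f (exp u))) u =
      exp u ^ 2 * deriv (deriv f) (exp u) / f (exp u) + exp u * deriv f (exp u) / f (exp u)
        - (exp u * deriv f (exp u) / f (exp u)) ^ 2 := by
  have hev : deriv (fun u => Real.log (f (exp u))) =ᶠ[𝓝 u]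
      fun u => exp u * deriv f (exp u) / f (exp u) := by
    filter_upwards [Real.continuous_exp.continuousAt.eventually (Ioi_mem_nhds hu)] with v hv
    exact (hasDerivAt_log_comp_exp hpos h hv).deriv
  obtain ⟨h1, h2⟩ := hasDerivAt_of_contDiffOn_Ioi h hu
  have he := Real.hasDerivAt_exp u
  have hne := (hpos _ hu).ne'
  have key := (he.mul (h2.comp u he)).div (h1.comp u he) hne
  rw [iteratedDeriv_succ, iteratedDeriv_one, hev.deriv_eq]
  refine (HasDerivAt.deriv key).trans ?_
  simp only [Function.comp, Pi.mul_apply]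
  field_simp
  ring

lemma tendsto_mul_deriv_div (hf : SmoothRegVary α f) :
    Tendsto (fun x => x * deriv f x / f x) atTop (𝓝 α) := by
  obtain ⟨z₀, hz, hpos, hsm, h1, -⟩ := hf
  refine (h1.comp Real.tendsto_log_atTop).congr' ?_
  filter_upwards [eventually_gt_atTop z₀] with x hx
  have hx' : exp (Real.log x) = x := Real.exp_log (by linarith)
  simpa [hx'] using (hasDerivAt_log_comp_exp hpos hsm (u := Real.log x) (by rwa [hx'])).deriv

lemma tendsto_sq_mul_deriv_deriv_div (hf : SmoothRegVary α f) :
    Tendsto (fun x => x ^ 2 * deriv (deriv f) x / f x) atTop (𝓝 (α * (α - 1))) := by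
  have h1 := hf.tendsto_mul_deriv_div
  obtain ⟨z₀, hz, hpos, hsm, -, h2⟩ := hf
  have h3 := (((h2 2 le_rfl).comp Real.tendsto_log_atTop).sub h1).add (h1.pow 2)
  rw [show α * (α - 1) = 0 - α + α ^ 2 by ring]
  refine h3.congr' ?_
  filter_upwards [eventually_gt_atTop z₀] with x hx
  have hx' : exp (Real.log x) = x := Real.exp_log (by linarith)
  have := iteratedDeriv_two_log_comp_exp hpos hsm (u := Real.log x) (by rwa [hx'])
  simp only [Function.comp, this, hx']
  ring

lemma eventually_pos (hf : SmoothRegVary α f) : ∀ᶠ x in atTop, 0 < f x := by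
  obtain ⟨z₀, -, hpos, -⟩ := hf
  filter_upwards [eventually_gt_atTop z₀] with x hx using hpos x hx

lemma eventually_deriv_deriv_pos (hα : 1 < α) (hf : SmoothRegVary α f) :
    ∀ᶠ x in atTop, 0 < deriv (deriv f) x := by
  have hlim : (0 : ℝ) < α * (α - 1) := mul_pos (by linarith) (by linarith)
  filter_upwards [hf.eventually_pos, eventually_gt_atTop 0,
    hf.tendsto_sq_mul_deriv_deriv_div.eventually (lt_mem_nhds hlim)] with x hx h0 h
  rw [lt_div_iff₀ hx, zero_mul] at h
  exact pos_of_mul_pos_right h (by positivity)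

lemma tendsto_div_of_tendsto_div {ι : Type*} {l : Filter ι} {a b : ι → ℝ}
    (hf : SmoothRegVary α f) (ha : Tendsto a l atTop) (hb : Tendsto b l atTop)
    (hab : Tendsto (fun i => b i / a i) l (𝓝 1)) :
    Tendsto (fun i => f (b i) / f (a i)) l (𝓝 1) := by
  have hpos' := hf.eventually_pos
  obtain ⟨z₀, hz, hpos, hsm, h1, -⟩ := hf
  obtain ⟨U, hU⟩ := eventually_atTop.1 ((h1.norm.eventually_lt_const
    (lt_add_one ‖α‖)).and (Real.tendsto_exp_atTop.eventually_gt_atTop z₀))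
  have hlog : Tendsto (fun i => Real.log (b i / a i)) l (𝓝 0) := by
    simpa using hab.log one_ne_zero
  have hdiff : Tendsto (fun i => Real.log (f (b i)) - Real.log (f (a i))) l (𝓝 0) := by
    refine squeeze_zero_norm' ?_
      (show Tendsto (fun i => (‖α‖ + 1) * ‖Real.log (b i / a i)‖) l (𝓝 0) by
        simpa using hlog.norm.const_mul (‖α‖ + 1))
    filter_upwards [ha.eventually_gt_atTop 0, hb.eventually_gt_atTop 0,
      (Real.tendsto_log_atTop.comp ha).eventually_ge_atTop U,
      (Real.tendsto_log_atTop.comp hb).eventually_ge_atTop U] with i ha0 hb0 haU hbU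
    have := (convex_Ici U).norm_image_sub_le_of_norm_deriv_le
      (f := fun u => Real.log (f (exp u)))
      (fun u hu => (hasDerivAt_log_comp_exp hpos hsm (hU u hu).2).differentiableAt)
      (fun u hu => (hU u hu).1.le) haU hbU
    simpa [Real.exp_log ha0, Real.exp_log hb0, Real.log_div hb0.ne' ha0.ne'] using this
  have hexp := (Real.continuous_exp.tendsto 0).comp hdiff
  rw [Real.exp_zero] at hexp
  refine hexp.congr' ?_
  filter_upwards [ha.eventually hpos', hb.eventually hpos'] with i hfa hfb
  simp [Real.exp_sub, Real.exp_log hfa, Real.exp_log hfb]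

lemma tendsto_deriv_deriv_div_of_tendsto_div {ι : Type*} {l : Filter ι} {a b : ι → ℝ} (hα : 1 < α)
    (hf : SmoothRegVary α f) (ha : Tendsto a l atTop) (hb : Tendsto b l atTop)
    (hab : Tendsto (fun i => b i / a i) l (𝓝 1)) :
    Tendsto (fun i => deriv (deriv f) (b i) / deriv (deriv f) (a i)) l (𝓝 1) := by
  have hlim : α * (α - 1) ≠ 0 := (mul_pos (by linarith) (by linarith)).ne'
  have hF := hf.tendsto_sq_mul_deriv_deriv_div
  have h := (((hF.comp hb).div (hF.comp ha) hlim).mul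
    (hf.tendsto_div_of_tendsto_div ha hb hab)).div (hab.pow 2) (by norm_num)
  rw [div_self hlim, one_pow, mul_one, div_one] at h
  refine h.congr' ?_
  filter_upwards [ha.eventually hf.eventually_pos, hb.eventually hf.eventually_pos,
    ha.eventually (hf.eventually_deriv_deriv_pos hα),
    ha.eventually_gt_atTop 0, hb.eventually_gt_atTop 0] with i h1 h2 h3 h4 h5
  simp only [Function.comp, Pi.div_apply]
  field_simp

lemma tendsto_deriv_div_of_tendsto_div {ι : Type*} {l : Filter ι} {a b : ι → ℝ} (hα : 1 < α)
    (hf : SmoothRegVary α f) (ha : Tendsto a l atTop)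
    (hab : Tendsto (fun i => b i / a i) l (𝓝 1)) :
    Tendsto (fun i => deriv f (a i) / (b i * deriv (deriv f) (a i))) l (𝓝 (α - 1)⁻¹) := by
  have hlim : α * (α - 1) ≠ 0 := (mul_pos (by linarith) (by linarith)).ne'
  have h := ((hf.tendsto_mul_deriv_div.comp ha).div
    (hf.tendsto_sq_mul_deriv_deriv_div.comp ha) hlim).div hab one_ne_zero
  have hα0 : α ≠ 0 := by linarith
  rw [div_one, div_mul_cancel_left₀ hα0] at h
  refine h.congr' ?_
  filter_upwards [ha.eventually hf.eventually_pos,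
    ha.eventually (hf.eventually_deriv_deriv_pos hα), ha.eventually_gt_atTop 0,
    hab.eventually (lt_mem_nhds one_pos)] with i h1 h3 h4 h5
  have h6 : 0 < b i := by rwa [lt_div_iff₀ h4, zero_mul] at h5
  simp only [Function.comp, Pi.div_apply]
  field_simp

end SmoothRegVary

/-- A filter on pairs `(ρ, x)` with `ρ → ∞` and `|x - ρ| ≤ ρ ^ c`. -/
def nearDiagonal (c : ℝ) : Filter (ℝ × ℝ) :=
  comap Prod.fst atTop ⊓ 𝓟 {p | |p.2 - p.1| ≤ p.1 ^ c}

lemma eventually_nearDiagonal {c : ℝ} {P : ℝ × ℝ → Prop} (h : ∀ᶠ p in nearDiagonal c, P p) :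
    ∀ᶠ ρ in atTop, ∀ x, |x - ρ| ≤ ρ ^ c → P (ρ, x) := by
  rw [nearDiagonal, eventually_inf_principal, eventually_comap] at h
  filter_upwards [h] with ρ hρ x hx using hρ (ρ, x) rfl hx

lemma tendsto_fst_nearDiagonal (c : ℝ) : Tendsto Prod.fst (nearDiagonal c) atTop :=
  tendsto_comap.mono_left inf_le_left

lemma tendsto_rpow_div_self {c : ℝ} (hc : c < 1) :
    Tendsto (fun x : ℝ => x ^ c / x) atTop (𝓝 0) := by
  refine (tendsto_rpow_neg_atTop (sub_pos.2 hc)).congr' ?_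
  filter_upwards [eventually_gt_atTop 0] with x hx
  rw [neg_sub, Real.rpow_sub_one hx.ne']

lemma tendsto_snd_div_fst_nearDiagonal {c : ℝ} (hc : c < 1) :
    Tendsto (fun p : ℝ × ℝ => p.2 / p.1) (nearDiagonal c) (𝓝 1) := by
  rw [tendsto_iff_norm_sub_tendsto_zero]
  refine squeeze_zero' (.of_forall fun _ => norm_nonneg _) ?_
    ((tendsto_rpow_div_self hc).comp (tendsto_fst_nearDiagonal c))
  filter_upwards [(tendsto_fst_nearDiagonal c).eventually_gt_atTop 0,
    mem_inf_of_right (mem_principal_self _)] with p h0 hp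
  rw [div_sub_one h0.ne', Real.norm_eq_abs, abs_div, abs_of_pos h0]
  exact div_le_div_of_nonneg_right hp h0.le

lemma tendsto_snd_nearDiagonal {c : ℝ} (hc : c < 1) :
    Tendsto Prod.snd (nearDiagonal c) atTop := by
  refine ((tendsto_snd_div_fst_nearDiagonal hc).pos_mul_atTop one_pos
    (tendsto_fst_nearDiagonal c)).congr' ?_
  filter_upwards [(tendsto_fst_nearDiagonal c).eventually_gt_atTop 0] with p h0
  exact div_mul_cancel₀ _ h0.ne'

lemma tendsto_rpow_fst_div_snd_nearDiagonal {c : ℝ} (hc : c < 1) :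
    Tendsto (fun p : ℝ × ℝ => p.1 ^ c / p.2) (nearDiagonal c) (𝓝 0) := by
  have h := ((tendsto_rpow_div_self hc).comp (tendsto_fst_nearDiagonal c)).div
    (tendsto_snd_div_fst_nearDiagonal hc) one_ne_zero
  rw [zero_div] at h
  refine h.congr' ?_
  filter_upwards [(tendsto_fst_nearDiagonal c).eventually_gt_atTop 0] with p h0
  simp only [Function.comp, Pi.div_apply]
  field_simp

/-- If the second derivative is within `M` of its value at `a`, the second-order Taylor polynomial
at `a` is accurate up to `M * (b - a) ^ 2`. -/
lemma abs_sub_taylor_two_le {f : ℝ → ℝ} {a b M : ℝ}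
    (h1 : ∀ x ∈ Set.uIcc a b, HasDerivAt f (deriv f x) x)
    (h2 : ∀ x ∈ Set.uIcc a b, HasDerivAt (deriv f) (deriv (deriv f) x) x)
    (hM : ∀ x ∈ Set.uIcc a b, |deriv (deriv f) x - deriv (deriv f) a| ≤ M) :
    |f b - f a - (b - a) * deriv f a - 1 / 2 * deriv (deriv f) a * (b - a) ^ 2|
      ≤ M * (b - a) ^ 2 := by
  have hM0 : 0 ≤ M := (abs_nonneg _).trans (hM a Set.left_mem_uIcc)
  have hd (x) (hx : x ∈ Set.uIcc a b) :
      |deriv f x - deriv f a - deriv (deriv f) a * (x - a)| ≤ M * |b - a| := by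
    have h := (convex_uIcc a b).norm_image_sub_le_of_norm_hasDerivWithin_le
      (f := fun x => deriv f x - deriv (deriv f) a * x)
      (f' := fun x => deriv (deriv f) x - deriv (deriv f) a) (C := M)
      (fun x hx => by
        refine HasDerivAt.hasDerivWithinAt ?_
        simpa using (h2 x hx).fun_sub ((hasDerivAt_id' x).const_mul (deriv (deriv f) a)))
      hM Set.left_mem_uIcc hx
    simp only [Real.norm_eq_abs] at h
    calc _ = |deriv f x - deriv (deriv f) a * x - (deriv f a - deriv (deriv f) a * a)| := by
          congr 1; ring
      _ ≤ M * |x - a| := h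
      _ ≤ M * |b - a| := mul_le_mul_of_nonneg_left (Set.abs_sub_left_of_mem_uIcc hx) hM0
  have h := (convex_uIcc a b).norm_image_sub_le_of_norm_hasDerivWithin_le
    (f := fun x => f x - deriv f a * x - 1 / 2 * deriv (deriv f) a * (x - a) ^ 2)
    (f' := fun x => deriv f x - deriv f a - deriv (deriv f) a * (x - a)) (C := M * |b - a|)
    (fun x hx => by
      have := ((h1 x hx).fun_sub ((hasDerivAt_id' x).const_mul (deriv f a))).fun_sub
        ((((hasDerivAt_id' x).sub_const a).fun_pow 2).const_mul (1 / 2 * deriv (deriv f) a))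
      refine (this.congr_deriv ?_).hasDerivWithinAt
      push_cast
      ring)
    hd Set.left_mem_uIcc Set.right_mem_uIcc
  simp only [Real.norm_eq_abs] at h
  calc _ = |f b - deriv f a * b - 1 / 2 * deriv (deriv f) a * (b - a) ^ 2
        - (f a - deriv f a * a - 1 / 2 * deriv (deriv f) a * (a - a) ^ 2)| := by congr 1; ring
    _ ≤ M * |b - a| * |b - a| := h
    _ = M * (b - a) ^ 2 := by rw [mul_assoc, abs_mul_abs_self, sq]

lemma EuclideanSpace.norm_sq_eq_add_sum_erase {ι : Type*} [Fintype ι] [DecidableEq ι]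
    (x : EuclideanSpace ℝ ι) (i : ι) :
    ‖x‖ ^ 2 = x i ^ 2 + ∑ j ∈ Finset.univ.erase i, x j ^ 2 := by
  rw [EuclideanSpace.real_norm_sq_eq, Finset.add_sum_erase _ (fun j => x j ^ 2) (Finset.mem_univ i)]

lemma EuclideanSpace.norm_smul_single_add_sq {ι : Type*} [Fintype ι] [DecidableEq ι]
    (ρ : ℝ) (z : EuclideanSpace ℝ ι) (i : ι) :
    ‖ρ • EuclideanSpace.single i (1 : ℝ) + z‖ ^ 2
      = (ρ + z i) ^ 2 + ∑ j ∈ Finset.univ.erase i, z j ^ 2 := by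
  rw [EuclideanSpace.norm_sq_eq_add_sum_erase _ i]
  congr 1
  · simp
  · refine Finset.sum_congr rfl fun j hj => ?_
    simp [Finset.ne_of_mem_erase hj]

/-- The algebraic core of the expansion: `T` is the mean of `r` and `ρ + t`, and `q` is the
squared length of the component orthogonal to the axis. -/
lemma abs_expansion_le {F A B β ε ρ r t q N : ℝ} (hB : 0 < B) (hN : N ^ 2 = t ^ 2 + q)
    (hN0 : 0 ≤ N) (hq : 0 ≤ q) (hr : r ^ 2 = (ρ + t) ^ 2 + q) (hrρ : |r - ρ| ≤ N)
    (hT : 0 < (r + ρ + t) / 2)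
    (hF : |F - (r - ρ) * A - 1 / 2 * B * (r - ρ) ^ 2| ≤ ε * B * (r - ρ) ^ 2)
    (hA : |A / ((r + ρ + t) / 2 * B) - β| ≤ ε) (hNT : N / ((r + ρ + t) / 2) ≤ ε) :
    |F - t * A - 1 / 2 * B * (t ^ 2 + β * q)| ≤ 3 * ε * N ^ 2 * B := by
  set T := (r + ρ + t) / 2 with hTdef
  have hε : 0 ≤ ε := (abs_nonneg _).trans hA
  have htN : |t| ≤ N := abs_le_of_sq_le_sq (by linarith) hN0
  have hs : r - ρ - t = q / (2 * T) := by
    rw [eq_div_iff (by positivity), hTdef]; linear_combination hr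
  have hqN : q ≤ N ^ 2 := by nlinarith [sq_nonneg t]
  have hsN : (r - ρ) ^ 2 ≤ N ^ 2 := sq_le_sq' (by linarith [abs_le.1 hrρ]) (abs_le.1 hrρ).2
  have key : F - t * A - 1 / 2 * B * (t ^ 2 + β * q)
      = (F - (r - ρ) * A - 1 / 2 * B * (r - ρ) ^ 2)
        + 1 / 2 * (B * q) * (A / (T * B) - β)
        + 1 / 2 * B * (q / (2 * T)) * (r - ρ + t) := by
    have h1 : 1 / 2 * (B * q) * (A / (T * B) - β) = A * (q / (2 * T)) - 1 / 2 * B * β * q := by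
      field_simp
    rw [h1, ← hs]
    ring
  have b1 : |F - (r - ρ) * A - 1 / 2 * B * (r - ρ) ^ 2| ≤ ε * B * N ^ 2 :=
    hF.trans (by gcongr)
  have b2 : |1 / 2 * (B * q) * (A / (T * B) - β)| ≤ 1 / 2 * (B * N ^ 2) * ε := by
    rw [abs_mul, abs_of_nonneg (by positivity : 0 ≤ 1 / 2 * (B * q))]
    gcongr
  have b3 : |1 / 2 * B * (q / (2 * T)) * (r - ρ + t)| ≤ 1 / 2 * B * N ^ 2 * ε := by
    rw [abs_mul, abs_of_nonneg (by positivity : 0 ≤ 1 / 2 * B * (q / (2 * T)))]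
    calc _ ≤ 1 / 2 * B * (q / (2 * T)) * (N + N) := by
          gcongr; exact (abs_add_le _ _).trans (add_le_add hrρ htN)
      _ = 1 / 2 * B * q * (N / T) := by field_simp; ring
      _ ≤ _ := by gcongr
  rw [key]
  calc _ ≤ ε * B * N ^ 2 + 1 / 2 * (B * N ^ 2) * ε + 1 / 2 * B * N ^ 2 * ε :=
        (abs_add_le _ _).trans (add_le_add ((abs_add_le _ _).trans (add_le_add b1 b2)) b3)
    _ ≤ _ := by nlinarith [show 0 ≤ ε * B * N ^ 2 by positivity]

/-- Estimate (3.8): second-order Taylor-type expansion of `z ↦ f(‖ρ e₁ + z‖)` around `0`,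
with curvature `f''(ρ)` in the direction `e₁` and `f''(ρ)/(α-1)` in orthogonal directions. -/
theorem stmt9 {n : ℕ} [NeZero n] {α : ℝ} (hα : 1 < α) {f : ℝ → ℝ}
    (hf : SmoothRegVary α f)
    {c : ℝ} (hc : c ∈ Set.Ioo (1 - α / 2) 1) {δ : ℝ} (hδ : 0 < δ) :
    ∃ k > (0 : ℝ), ∀ ρ : ℝ, k < ρ → ∀ z : EuclideanSpace ℝ (Fin n), ‖z‖ ≤ ρ ^ c →
      |f ‖ρ • EuclideanSpace.single (0 : Fin n) (1 : ℝ) + z‖ - f ρ - z 0 * deriv f ρ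
          - 1 / 2 * deriv (deriv f) ρ *
            (z 0 ^ 2 + (α - 1)⁻¹ * ∑ i ∈ Finset.univ.erase (0 : Fin n), z i ^ 2)|
        ≤ δ * ‖z‖ ^ 2 * deriv (deriv f) ρ := by
  have hc1 : c < 1 := hc.2
  have hε : 0 < δ / 3 := by positivity
  have hfst := tendsto_fst_nearDiagonal c
  have hratio := tendsto_snd_div_fst_nearDiagonal hc1
  have hsnd := tendsto_snd_nearDiagonal hc1
  have e1 := eventually_nearDiagonal <|
    (hf.tendsto_deriv_deriv_div_of_tendsto_div hα hfst hsnd hratio).eventually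
      (Metric.closedBall_mem_nhds _ hε)
  have e2 := eventually_nearDiagonal <|
    (hf.tendsto_deriv_div_of_tendsto_div hα hfst hratio).eventually
      (Metric.closedBall_mem_nhds _ hε)
  have e3 := eventually_nearDiagonal <|
    (tendsto_rpow_fst_div_snd_nearDiagonal hc1).eventually_le_const hε
  have e4 := hf.eventually_deriv_deriv_pos hα
  obtain ⟨z₀, hz₀, hpos, hsm, -⟩ := hf
  have e5 := eventually_nearDiagonal (hsnd.eventually_gt_atTop z₀)
  obtain ⟨k, hk⟩ := eventually_atTop.1
    (e1.and (e2.and (e3.and (e4.and (e5.and (eventually_gt_atTop (0 : ℝ)))))))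
  refine ⟨max k 1, by positivity, fun ρ hρ z hz => ?_⟩
  obtain ⟨e1, e2, e3, hB, e5, hρ0⟩ := hk ρ ((le_max_left _ _).trans hρ.le)
  have hr := EuclideanSpace.norm_smul_single_add_sq ρ z 0
  have hN := EuclideanSpace.norm_sq_eq_add_sum_erase z 0
  have hrρ : |‖ρ • EuclideanSpace.single (0 : Fin n) (1 : ℝ) + z‖ - ρ| ≤ ‖z‖ := by
    have h := abs_norm_sub_norm_le (ρ • EuclideanSpace.single (0 : Fin n) (1 : ℝ) + z)
      (ρ • EuclideanSpace.single (0 : Fin n) (1 : ℝ))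
    simpa [norm_smul, abs_of_pos hρ0] using h
  have hq : 0 ≤ ∑ i ∈ Finset.univ.erase (0 : Fin n), z i ^ 2 :=
    Finset.sum_nonneg fun i _ => sq_nonneg _
  set r := ‖ρ • EuclideanSpace.single (0 : Fin n) (1 : ℝ) + z‖
  have ht : |z 0| ≤ ‖z‖ := abs_le_of_sq_le_sq (by linarith) (norm_nonneg z)
  have hT : |(r + ρ + z 0) / 2 - ρ| ≤ ρ ^ c := by
    rw [abs_le] at hrρ ht ⊢
    constructor <;> linarith
  have hT0 : 0 < (r + ρ + z 0) / 2 := by linarith [e5 _ hT]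
  have hclose (x) (hx : x ∈ Set.uIcc ρ r) : |x - ρ| ≤ ρ ^ c :=
    (Set.abs_sub_left_of_mem_uIcc hx).trans (hrρ.trans hz)
  have hTaylor := abs_sub_taylor_two_le (f := f) (a := ρ) (b := r)
    (M := δ / 3 * deriv (deriv f) ρ)
    (fun x hx => (SmoothRegVary.hasDerivAt_of_contDiffOn_Ioi hsm (e5 x (hclose x hx))).1)
    (fun x hx => (SmoothRegVary.hasDerivAt_of_contDiffOn_Ioi hsm (e5 x (hclose x hx))).2)
    (fun x hx => by
      have h := e1 x (hclose x hx)
      rw [Real.dist_eq, div_sub_one hB.ne', abs_div, abs_of_pos hB,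
        div_le_iff₀ hB] at h
      exact h)
  have h := abs_expansion_le (β := (α - 1)⁻¹) hB hN (norm_nonneg z) hq hr hrρ hT0 hTaylor
    (e2 _ hT) ((div_le_div_of_nonneg_right hz hT0.le).trans (e3 _ hT))
  rwa [mul_div_cancel₀ δ three_ne_zero] at h
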